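/- Let V be a complex vector space of dimension k ≥ 1, let m ≥ 1, and let D ⊆ {1,…,k} × {1,…,m} be a diagram containing a full column c = {(1,j₀), (2,j₀), …, (k,j₀)} for some j₀ (so c = D ∩ (ℤ × {j₀}) has exactly k cells). Then there is a GL(V)-equivariant linear isomorphism V[D] ≅ V[c] ⊗ V[D∖c], where V[c] is one-dimensional and isomorphic to the k-th exterior power of V. -/

import Mathlib

open scoped TensorProduct

/-- The Young symmetrizer operator of a finite diagram `D ⊆ ℤ²` on `V^{⊗D}`. -/
noncomputable def youngOp (V : Type*) [AddCommGroup V] [Module ℂ V]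
    (D : Finset (ℤ × ℤ)) :
    (⨂[ℂ] _ : D, V) →ₗ[ℂ] (⨂[ℂ] _ : D, V) :=
  ∑ p : Equiv.Perm D, ∑ q : Equiv.Perm D,
    if (∀ x : D, ((p x : ℤ × ℤ)).1 = (x : ℤ × ℤ).1) ∧
        (∀ x : D, ((q x : ℤ × ℤ)).2 = (x : ℤ × ℤ).2) then
      ((Equiv.Perm.sign q : ℤ) : ℂ) •
        (PiTensorProduct.reindex ℂ (fun _ : D => V) (q * p)).toLinearMap
    else 0

/-- The generalized Schur module `V[D] = V^{⊗D}·y_D`. -/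
noncomputable def schurModule (V : Type*) [AddCommGroup V] [Module ℂ V]
    (D : Finset (ℤ × ℤ)) : Submodule ℂ (⨂[ℂ] _ : D, V) :=
  LinearMap.range (youngOp V D)

/-- The diagonal action of `g ∈ GL(V)` on the tensor power `V^{⊗D}`. -/
noncomputable def glOp (V : Type*) [AddCommGroup V] [Module ℂ V]
    (D : Finset (ℤ × ℤ)) (g : V ≃ₗ[ℂ] V) :
    (⨂[ℂ] _ : D, V) →ₗ[ℂ] (⨂[ℂ] _ : D, V) :=
  PiTensorProduct.map (fun _ : D => g.toLinearMap)

/-- Polarization: a multilinear form vanishing on row-constant families has vanishing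
row symmetrization, and conversely. -/
theorem polar_aux {V : Type*} [AddCommGroup V] [Module ℂ V] {α : Type*} [Fintype α]
    [DecidableEq α] (r : α → ℤ) (G : MultilinearMap ℂ (fun _ : α => V) ℂ) :
    (∀ v : α → V, (∑ p : Equiv.Perm α, if (∀ x, r (p x) = r x) then
      G (fun x => v (p.symm x)) else 0) = 0) ↔ ∀ w : ℤ → V, G (fun x => w (r x)) = 0 := by
  constructor
  · intro h w
    have h1 := h (fun x => w (r x))
    have h2 : ∀ p : Equiv.Perm α, (if (∀ x, r (p x) = r x) then
      G (fun x => w (r (p.symm x))) else 0) =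
      (if (∀ x, r (p x) = r x) then (1 : ℂ) else 0) * G (fun x => w (r x)) := by
      intro p
      split_ifs with hp
      · have : ∀ x, r (p.symm x) = r x := fun x => by
          have := hp (p.symm x); simpa using this.symm
        simp [this]
      · simp
    simp only [h2] at h1
    rw [← Finset.sum_mul] at h1
    rcases mul_eq_zero.1 h1 with h3 | h3
    · exfalso
      rw [Finset.sum_boole] at h3
      have h4 := Nat.cast_eq_zero.1 h3
      rw [Finset.card_eq_zero] at h4
      have : (1 : Equiv.Perm α) ∈ (Finset.univ.filter
        (fun p : Equiv.Perm α => ∀ x, r (p x) = r x)) := by simp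
      rw [h4] at this
      simp at this
    · exact h3
  · intro h v
    let P : MvPolynomial α ℂ := ∑ f : α → α,
      MvPolynomial.C ((if (∀ x, r (f x) = r x) then (1 : ℂ) else 0) * G (fun x => v (f x))) *
        ∏ x, MvPolynomial.X (f x)
    have hP : P = 0 := by
      apply MvPolynomial.funext
      intro t
      have h1 := h (fun i => ∑ y : α, if r y = i then t y • v y else 0)
      rw [MultilinearMap.map_sum] at h1
      rw [map_zero, ← h1]
      simp only [P, map_sum, map_mul, map_prod, MvPolynomial.eval_C, MvPolynomial.eval_X]
      refine Finset.sum_congr rfl fun f _ => ?_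
      by_cases hf : ∀ x, r (f x) = r x
      · simp only [hf, implies_true, if_true, one_mul]
        rw [MultilinearMap.map_smul_univ, smul_eq_mul, mul_comm]
      · rw [if_neg hf]
        push Not at hf
        obtain ⟨x, hx⟩ := hf
        have h0 : G (fun i => if r (f i) = r i then t (f i) • v (f i) else 0) = 0 :=
          G.map_coord_zero x (if_neg hx)
        rw [h0]
        simp
    have hmon : ∀ f : α → α, (∏ x, MvPolynomial.X (f x) : MvPolynomial α ℂ) =
        MvPolynomial.monomial (∑ x, Finsupp.single (f x) 1) 1 := by
      intro f
      rw [MvPolynomial.monomial_sum_one]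
      rfl
    have hc := congrArg (MvPolynomial.coeff (∑ x : α, Finsupp.single x 1)) hP
    simp only [P, hmon, MvPolynomial.coeff_sum, MvPolynomial.coeff_C_mul,
      MvPolynomial.coeff_monomial, MvPolynomial.coeff_zero] at hc
    refine Eq.trans ?_ hc
    have hbij : ∀ f : α → α, (∑ x, Finsupp.single (f x) 1 : α →₀ ℕ) =
        (∑ x : α, Finsupp.single x 1) → Function.Bijective f := by
      intro f hf
      rw [← Finite.surjective_iff_bijective]
      intro y
      have := DFunLike.congr_fun hf y
      simp only [Finsupp.coe_finsetSum, Finset.sum_apply, Finsupp.single_apply] at this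
      by_contra hy
      push Not at hy
      simp [hy] at this
    refine Finset.sum_of_injOn (fun p : Equiv.Perm α => (p.symm : α → α)) ?_ ?_ ?_ ?_
    · intro p _ q _ hpq
      have : p.symm = q.symm := Equiv.coe_fn_injective hpq
      simpa using congrArg Equiv.symm this
    · simp
    · intro f _ hf
      by_cases hb : (∑ x, Finsupp.single (f x) 1 : α →₀ ℕ) = (∑ x : α, Finsupp.single x 1)
      · exfalso
        apply hf
        exact ⟨(Equiv.ofBijective f (hbij f hb)).symm, by simp, by ext; simp⟩
      · rw [if_neg hb, mul_zero]
    · intro p _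
      have h1 : (∑ x, Finsupp.single (p.symm x) 1 : α →₀ ℕ) = ∑ x : α, Finsupp.single x 1 :=
        Equiv.sum_comp p.symm (fun x => (Finsupp.single x 1 : α →₀ ℕ))
      rw [if_pos h1, mul_one]
      have h2 : (∀ x, r (p.symm x) = r x) ↔ (∀ x, r (p x) = r x) := by
        constructor
        · intro h x; have := h (p x); simpa using this.symm
        · intro h x; have := h (p.symm x); simpa using this.symm
      simp only [h2]
      split_ifs <;> simp

/-- An alternating map in `dim V` variables is a multiple of the determinant. -/
theorem alt_eq_det {V W : Type*} [AddCommGroup V] [Module ℂ V] [AddCommGroup W] [Module ℂ W]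
    {α : Type*} [Fintype α] [DecidableEq α] (b : Module.Basis α ℂ V)
    (f : V [⋀^α]→ₗ[ℂ] W) (u : α → V) : f u = b.det u • f b := by
  have : f = (LinearMap.toSpanSingleton ℂ W (f b)).compAlternatingMap b.det := by
    refine Module.Basis.ext_alternating b fun i h => ?_
    let σ : Equiv.Perm α := Equiv.ofBijective i (Finite.injective_iff_bijective.1 h)
    change f (b ∘ σ) = ((LinearMap.toSpanSingleton ℂ W (f b)).compAlternatingMap b.det) (b ∘ σ)
    simp only [AlternatingMap.map_perm]
    simp [Module.Basis.det_self]
  conv_lhs => rw [this]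
  simp

/-- The density argument. -/
theorem density_aux {V : Type*} [AddCommGroup V] [Module ℂ V]
    {α β : Type*} [Fintype α] [DecidableEq α] [Fintype β] [DecidableEq β]
    (b : Module.Basis α ℂ V) (r : α → ℤ) (hr : Function.Injective r) (s : β → ℤ)
    (H : MultilinearMap ℂ (fun _ : β => V) ℂ)
    (h : ∀ w : ℤ → V, b.det (fun x => w (r x)) * H (fun y => w (s y)) = 0) (w : ℤ → V) :
    H (fun y => w (s y)) = 0 := by
  let b' : ℤ → V := Function.extend r b 0
  have hb' : ∀ x, b' (r x) = b x := fun x => hr.extend_apply _ _ _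
  let M : Matrix α α ℂ := b.toMatrix (fun x => w (r x))
  let P : Polynomial ℂ := (-M).charpoly
  let Q : Polynomial ℂ := ∑ S : Finset β, Polynomial.C
    (H (S.piecewise (fun y => b' (s y)) (fun y => w (s y)))) * Polynomial.X ^ S.card
  have hP : ∀ t, P.eval t = b.det (fun x => (t • b' + w) (r x)) := by
    intro t
    rw [Matrix.eval_charpoly, Module.Basis.det_apply]
    congr 1
    ext i j
    simp [M, Module.Basis.toMatrix_apply, hb', Matrix.diagonal_apply, Finsupp.single_apply, eq_comm]
  have hQ : ∀ t, Q.eval t = H (fun y => (t • b' + w) (s y)) := by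
    intro t
    have : (fun y => (t • b' + w) (s y)) = (fun y => t • b' (s y)) + (fun y => w (s y)) := by
      ext; simp
    rw [this, MultilinearMap.map_add_univ, Polynomial.eval_finsetSum]
    refine Finset.sum_congr rfl fun S _ => ?_
    have h2 : S.piecewise (fun y => t • b' (s y)) (fun y => w (s y)) =
      S.piecewise (fun i => (fun _ => t) i • (S.piecewise (fun y => b' (s y)) (fun y => w (s y))) i)
        (S.piecewise (fun y => b' (s y)) (fun y => w (s y))) := by
      ext y; by_cases hy : y ∈ S <;> simp [hy]
    rw [h2, MultilinearMap.map_piecewise_smul]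
    rw [Polynomial.eval_mul, Polynomial.eval_C, Polynomial.eval_pow, Polynomial.eval_X,
      Finset.prod_const, smul_eq_mul, mul_comm]
  have hPQ : P * Q = 0 := by
    apply Polynomial.funext
    intro t
    rw [Polynomial.eval_mul, hP, hQ, h, Polynomial.eval_zero]
  have hQ0 : Q = 0 := (mul_eq_zero.1 hPQ).resolve_left (Matrix.charpoly_monic _).ne_zero
  have := hQ 0
  rw [hQ0] at this
  simpa using this.symm

/-- Column antisymmetrizer. -/
noncomputable def colOp (V : Type*) [AddCommGroup V] [Module ℂ V]
    (D : Finset (ℤ × ℤ)) :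
    (⨂[ℂ] _ : D, V) →ₗ[ℂ] (⨂[ℂ] _ : D, V) :=
  ∑ q : Equiv.Perm D,
    if (∀ x : D, ((q x : ℤ × ℤ)).2 = (x : ℤ × ℤ).2) then
      ((Equiv.Perm.sign q : ℤ) : ℂ) •
        (PiTensorProduct.reindex ℂ (fun _ : D => V) q).toLinearMap
    else 0

theorem colOp_tprod {V : Type*} [AddCommGroup V] [Module ℂ V]
    (D : Finset (ℤ × ℤ)) (v : D → V) : colOp V D (PiTensorProduct.tprod ℂ v) =
    ∑ q : Equiv.Perm D, if (∀ x : D, ((q x : ℤ × ℤ)).2 = (x : ℤ × ℤ).2) then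
      ((Equiv.Perm.sign q : ℤ) : ℂ) • PiTensorProduct.tprod ℂ (fun x => v (q.symm x)) else 0 := by
  rw [colOp, LinearMap.sum_apply]
  refine Finset.sum_congr rfl fun q _ => ?_
  split_ifs
  · rw [LinearMap.smul_apply]
    congr 1
    exact PiTensorProduct.reindex_tprod q v
  · rfl

theorem youngOp_tprod {V : Type*} [AddCommGroup V] [Module ℂ V]
    (D : Finset (ℤ × ℤ)) (v : D → V) : youngOp V D (PiTensorProduct.tprod ℂ v) =
    ∑ p : Equiv.Perm D, if (∀ x : D, ((p x : ℤ × ℤ)).1 = (x : ℤ × ℤ).1) then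
      colOp V D (PiTensorProduct.tprod ℂ (fun x => v (p.symm x))) else 0 := by
  rw [youngOp, LinearMap.sum_apply]
  refine Finset.sum_congr rfl fun p _ => ?_
  rw [LinearMap.sum_apply]
  split_ifs with hp
  · rw [colOp_tprod]
    refine Finset.sum_congr rfl fun q _ => ?_
    by_cases hq : ∀ x : D, ((q x : ℤ × ℤ)).2 = (x : ℤ × ℤ).2
    · rw [if_pos ⟨hp, hq⟩, if_pos hq, LinearMap.smul_apply]
      congr 1
      exact PiTensorProduct.reindex_tprod (q * p) v
    · rw [if_neg (fun h => hq h.2), if_neg hq]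
      rfl
  · refine Finset.sum_eq_zero fun q _ => ?_
    rw [if_neg (fun h => hp h.1)]
    rfl

theorem comp_youngOp_eq_zero {V : Type*} [AddCommGroup V] [Module ℂ V]
    (D : Finset (ℤ × ℤ)) (φ : (⨂[ℂ] _ : D, V) →ₗ[ℂ] ℂ) :
    (∀ v, φ (youngOp V D (PiTensorProduct.tprod ℂ v)) = 0) ↔
      ∀ w : ℤ → V, φ (colOp V D (PiTensorProduct.tprod ℂ (fun x => w (x : ℤ × ℤ).1))) = 0 := by
  have := polar_aux (fun x : D => (x : ℤ × ℤ).1)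
    ((φ ∘ₗ colOp V D).compMultilinearMap (PiTensorProduct.tprod ℂ))
  refine Iff.trans ?_ this
  refine forall_congr' fun v => ?_
  rw [youngOp_tprod, map_sum]
  refine Eq.congr_left (Finset.sum_congr rfl fun p _ => ?_)
  split_ifs
  · rfl
  · simp

theorem glOp_youngOp {V : Type*} [AddCommGroup V] [Module ℂ V]
    (D : Finset (ℤ × ℤ)) (g : V ≃ₗ[ℂ] V) (t) :
    glOp V D g (youngOp V D t) = youngOp V D (glOp V D g t) := by
  have : glOp V D g ∘ₗ youngOp V D = youngOp V D ∘ₗ glOp V D g := by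
    ext v
    simp only [LinearMap.compMultilinearMap_apply, LinearMap.comp_apply]
    have h : ∀ u : D → V, glOp V D g (PiTensorProduct.tprod ℂ u) =
        PiTensorProduct.tprod ℂ (fun x => g (u x)) := fun u => by
      rw [glOp, PiTensorProduct.map_tprod]; rfl
    rw [h, youngOp_tprod, youngOp_tprod, map_sum]
    refine Finset.sum_congr rfl fun p _ => ?_
    rw [apply_ite (glOp V D g), map_zero]
    congr 1
    rw [colOp_tprod, colOp_tprod, map_sum]
    refine Finset.sum_congr rfl fun q _ => ?_
    rw [apply_ite (glOp V D g), map_zero, map_smul, h]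
  exact DFunLike.congr_fun this t

theorem schur_stable {V : Type*} [AddCommGroup V] [Module ℂ V]
    (D : Finset (ℤ × ℤ)) (g : V ≃ₗ[ℂ] V) : ∀ v ∈ schurModule V D,
        glOp V D g v ∈ schurModule V D := by
  rintro _ ⟨t, rfl⟩
  exact ⟨_, (glOp_youngOp D g t).symm⟩

/-- Splitting a diagram into a column and the rest. -/
noncomputable def splitEquiv (D : Finset (ℤ × ℤ)) (j₀ : ℤ) :
    (D.filter (fun x => x.2 = j₀)) ⊕ (D.filter (fun x => x.2 ≠ j₀)) ≃ D :=
  Equiv.ofBijective (Sum.elim (fun x => ⟨x.1, (Finset.mem_filter.1 x.2).1⟩)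
    (fun x => ⟨x.1, (Finset.mem_filter.1 x.2).1⟩)) (by
    constructor
    · rintro (⟨x, hx⟩ | ⟨x, hx⟩) (⟨y, hy⟩ | ⟨y, hy⟩) h
      · simpa using h
      · simp only [Sum.elim_inl, Sum.elim_inr, Subtype.mk.injEq] at h
        subst h
        exact absurd (Finset.mem_filter.1 hx).2 (Finset.mem_filter.1 hy).2
      · simp only [Sum.elim_inl, Sum.elim_inr, Subtype.mk.injEq] at h
        subst h
        exact absurd (Finset.mem_filter.1 hy).2 (Finset.mem_filter.1 hx).2
      · simpa using h
    · rintro ⟨x, hx⟩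
      by_cases h : x.2 = j₀
      · exact ⟨Sum.inl ⟨x, Finset.mem_filter.2 ⟨hx, h⟩⟩, rfl⟩
      · exact ⟨Sum.inr ⟨x, Finset.mem_filter.2 ⟨hx, h⟩⟩, rfl⟩)

theorem splitEquiv_inl (D : Finset (ℤ × ℤ)) (j₀ : ℤ) (x) :
    ((splitEquiv D j₀ (Sum.inl x) : D) : ℤ × ℤ) = x := rfl

theorem splitEquiv_inr (D : Finset (ℤ × ℤ)) (j₀ : ℤ) (x) :
    ((splitEquiv D j₀ (Sum.inr x) : D) : ℤ × ℤ) = x := rfl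

/-- The corresponding isomorphism of tensor powers. -/
noncomputable def splitT (V : Type*) [AddCommGroup V] [Module ℂ V]
    (D : Finset (ℤ × ℤ)) (j₀ : ℤ) :
    ((⨂[ℂ] _ : (D.filter (fun x => x.2 = j₀)), V) ⊗[ℂ]
      (⨂[ℂ] _ : (D.filter (fun x => x.2 ≠ j₀)), V)) ≃ₗ[ℂ] (⨂[ℂ] _ : D, V) :=
  (PiTensorProduct.tmulEquiv ℂ V).trans
    (PiTensorProduct.reindex ℂ (fun _ => V) (splitEquiv D j₀))

theorem splitT_tprod {V : Type*} [AddCommGroup V] [Module ℂ V]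
    (D : Finset (ℤ × ℤ)) (j₀ : ℤ) (u v) :
    splitT V D j₀ (PiTensorProduct.tprod ℂ u ⊗ₜ PiTensorProduct.tprod ℂ v) =
      PiTensorProduct.tprod ℂ (fun x => Sum.elim u v ((splitEquiv D j₀).symm x)) := by
  rw [splitT, LinearEquiv.trans_apply, PiTensorProduct.tmulEquiv_apply]
  exact PiTensorProduct.reindex_tprod _ _

theorem splitT_glOp {V : Type*} [AddCommGroup V] [Module ℂ V]
    (D : Finset (ℤ × ℤ)) (j₀ : ℤ) (g : V ≃ₗ[ℂ] V) (a b) :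
    glOp V D g (splitT V D j₀ (a ⊗ₜ b)) =
      splitT V D j₀ (glOp V _ g a ⊗ₜ glOp V _ g b) := by
  induction a using PiTensorProduct.induction_on with
  | smul_tprod r u =>
    induction b using PiTensorProduct.induction_on with
    | smul_tprod r' v =>
      simp only [← TensorProduct.smul_tmul', TensorProduct.tmul_smul, map_smul, splitT_tprod]
      rw [glOp, glOp, glOp, PiTensorProduct.map_tprod, PiTensorProduct.map_tprod,
        PiTensorProduct.map_tprod, splitT_tprod]
      congr 3
      ext x
      rcases (splitEquiv D j₀).symm x with y | y <;> rfl
    | add x y hx hy => simp only [TensorProduct.tmul_add, map_add, hx, hy]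
  | add x y hx hy => simp only [TensorProduct.add_tmul, map_add, hx, hy]

theorem splitT_colOp {V : Type*} [AddCommGroup V] [Module ℂ V]
    (D : Finset (ℤ × ℤ)) (j₀ : ℤ) (u v) :
    colOp V D (splitT V D j₀ (PiTensorProduct.tprod ℂ u ⊗ₜ PiTensorProduct.tprod ℂ v)) =
      splitT V D j₀ (colOp V _ (PiTensorProduct.tprod ℂ u) ⊗ₜ
        colOp V _ (PiTensorProduct.tprod ℂ v)) := by
  rw [splitT_tprod, colOp_tprod, colOp_tprod, colOp_tprod, TensorProduct.sum_tmul, map_sum]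
  simp only [TensorProduct.tmul_sum, map_sum]
  rw [← Finset.sum_product']
  symm
  refine Finset.sum_of_injOn
    (fun q => (splitEquiv D j₀).permCongr (Equiv.Perm.sumCongr q.1 q.2)) ?_ ?_ ?_ ?_
  · intro q _ q' _ h
    have h1 := (splitEquiv D j₀).permCongr.injective h
    have := Equiv.Perm.sumCongrHom_injective (a₁ := q) (a₂ := q') h1
    exact this
  · simp
  · intro q _ hq
    refine if_neg fun hc => hq ?_
    let q' : Equiv.Perm _ := (splitEquiv D j₀).symm.permCongr q
    have : q' ∈ (Equiv.Perm.sumCongrHom _ _).range := by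
      apply Equiv.Perm.mem_sumCongrHom_range_of_perm_mapsTo_inl
      rintro _ ⟨x, rfl⟩
      rcases hy : q' (Sum.inl x) with y | y
      · exact ⟨y, rfl⟩
      · exfalso
        have h1 : q (splitEquiv D j₀ (Sum.inl x)) = splitEquiv D j₀ (Sum.inr y) := by
          rw [← hy]; simp [q', Equiv.permCongr_apply]
        have h2 := hc (splitEquiv D j₀ (Sum.inl x))
        rw [h1, splitEquiv_inl, splitEquiv_inr, (Finset.mem_filter.1 x.2).2] at h2
        exact (Finset.mem_filter.1 y.2).2 h2
    obtain ⟨⟨q1, q2⟩, h⟩ := this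
    refine ⟨(q1, q2), by simp, ?_⟩
    have h' : Equiv.Perm.sumCongr q1 q2 = q' := h
    simp only [h', q']
    refine Equiv.ext fun x => ?_
    change splitEquiv D j₀ ((splitEquiv D j₀).symm
      (q (splitEquiv D j₀ ((splitEquiv D j₀).symm x)))) = q x
    simp
  · rintro ⟨q1, q2⟩ _
    have hiff : (∀ x : D, (((splitEquiv D j₀).permCongr (Equiv.Perm.sumCongr q1 q2) x : D)
        : ℤ × ℤ).2 = (x : ℤ × ℤ).2) ↔ (∀ x, ((q1 x : ℤ × ℤ)).2 = (x : ℤ × ℤ).2) ∧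
        (∀ x, ((q2 x : ℤ × ℤ)).2 = (x : ℤ × ℤ).2) := by
      rw [← (splitEquiv D j₀).forall_congr_right, Sum.forall]
      simp only [Equiv.permCongr_apply, Equiv.symm_apply_apply, Equiv.Perm.sumCongr_apply,
        Sum.map_inl, Sum.map_inr, splitEquiv_inl, splitEquiv_inr]
    dsimp only
    simp only [hiff]
    by_cases h1 : ∀ x, ((q1 x : ℤ × ℤ)).2 = (x : ℤ × ℤ).2
    · by_cases h2 : ∀ x, ((q2 x : ℤ × ℤ)).2 = (x : ℤ × ℤ).2
      · rw [if_pos h1, if_pos h2, if_pos ⟨h1, h2⟩, ← TensorProduct.smul_tmul',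
          TensorProduct.tmul_smul, map_smul, map_smul, splitT_tprod, smul_smul,
          Equiv.Perm.sign_permCongr, Equiv.Perm.sign_sumCongr]
        congr 1
        · push_cast; rfl
        · congr 1
          ext x
          obtain ⟨y, rfl⟩ := (splitEquiv D j₀).surjective x
          change _ = Sum.elim u v ((splitEquiv D j₀).symm (splitEquiv D j₀
            ((Equiv.Perm.sumCongr q1 q2).symm ((splitEquiv D j₀).symm (splitEquiv D j₀ y)))))
          rcases y with y | y <;> simp
      · rw [if_neg h2, TensorProduct.tmul_zero, map_zero, if_neg (fun h : _ ∧ _ => h2 h.2)]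
    · rw [if_neg h1, TensorProduct.zero_tmul, map_zero, if_neg (fun h : _ ∧ _ => h1 h.1)]

theorem range_le_of_dual {A B T : Type*} [AddCommGroup A] [Module ℂ A] [AddCommGroup B]
    [Module ℂ B] [AddCommGroup T] [Module ℂ T] (f : A →ₗ[ℂ] T) (g : B →ₗ[ℂ] T)
    (h : ∀ φ : T →ₗ[ℂ] ℂ, φ ∘ₗ g = 0 → φ ∘ₗ f = 0) : LinearMap.range f ≤ LinearMap.range g := by
  rintro _ ⟨x, rfl⟩
  by_contra hx
  obtain ⟨φ, h1, h2⟩ := Submodule.exists_le_ker_of_notMem hx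
  refine h1 (DFunLike.congr_fun (h φ ?_) x)
  ext y
  exact h2 ⟨y, rfl⟩

/-- On a single column the column operator is the alternatization. -/
theorem colOp_column {V : Type*} [AddCommGroup V] [Module ℂ V] (c : Finset (ℤ × ℤ)) (j₀ : ℤ)
    (hc : ∀ x ∈ c, x.2 = j₀) (u : c → V) :
    colOp V c (PiTensorProduct.tprod ℂ u) =
      MultilinearMap.alternatization (PiTensorProduct.tprod ℂ (s := fun _ : c => V)) u := by
  rw [colOp_tprod, MultilinearMap.alternatization_apply, ← Equiv.sum_comp (Equiv.inv _)]
  refine Finset.sum_congr rfl fun q _ => ?_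
  rw [if_pos (fun x => by rw [hc _ (Subtype.prop _), hc _ x.2])]
  simp only [Equiv.inv_apply, Equiv.Perm.sign_inv, MultilinearMap.domDomCongr_apply]
  rw [Units.smul_def, Int.cast_smul_eq_zsmul]
  rfl

theorem youngOp_column {V : Type*} [AddCommGroup V] [Module ℂ V] (c : Finset (ℤ × ℤ)) (j₀ : ℤ)
    (hc : ∀ x ∈ c, x.2 = j₀) (u : c → V) :
    youngOp V c (PiTensorProduct.tprod ℂ u) = colOp V c (PiTensorProduct.tprod ℂ u) := by
  rw [youngOp_tprod, Finset.sum_eq_single 1]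
  · refine (if_pos (fun x => rfl)).trans ?_
    rfl
  · intro p _ hp
    refine if_neg fun h => hp ?_
    ext x : 2
    exact Prod.ext (h x) (by rw [hc _ (Subtype.prop _), hc _ (Subtype.prop _)]; )
  · simp

theorem key_aux {V : Type*} [AddCommGroup V] [Module ℂ V] (D : Finset (ℤ × ℤ)) (j₀ : ℤ)
    (b : Module.Basis (D.filter (fun x => x.2 = j₀)) ℂ V) (φ : (⨂[ℂ] _ : D, V) →ₗ[ℂ] ℂ) :
    (∀ v, φ (youngOp V D (PiTensorProduct.tprod ℂ v)) = 0) ↔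
    ∀ u v, φ (splitT V D j₀ (youngOp V _ (PiTensorProduct.tprod ℂ u) ⊗ₜ
        youngOp V _ (PiTensorProduct.tprod ℂ v))) = 0 := by
  have hc : ∀ x ∈ D.filter (fun x => x.2 = j₀), x.2 = j₀ := fun x hx => (Finset.mem_filter.1 hx).2
  let ψ : (⨂[ℂ] _ : (D.filter (fun x => x.2 = j₀)), V) →
      (⨂[ℂ] _ : (D.filter (fun x => x.2 ≠ j₀)), V) →ₗ[ℂ] ℂ := fun a =>
    φ ∘ₗ (splitT V D j₀).toLinearMap ∘ₗ TensorProduct.mk ℂ _ _ a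
  have hψ : ∀ a t, ψ a t = φ (splitT V D j₀ (a ⊗ₜ t)) := fun _ _ => rfl
  have hR : (∀ u v, φ (splitT V D j₀ (youngOp V _ (PiTensorProduct.tprod ℂ u) ⊗ₜ
        youngOp V _ (PiTensorProduct.tprod ℂ v))) = 0) ↔
      ∀ (u : D.filter (fun x => x.2 = j₀) → V) (w : ℤ → V),
        ψ (colOp V _ (PiTensorProduct.tprod ℂ u))
        (colOp V _ (PiTensorProduct.tprod ℂ (fun x => w (x : ℤ × ℤ).1))) = 0 := by
    refine forall_congr' fun u => ?_
    rw [← comp_youngOp_eq_zero, youngOp_column _ j₀ hc]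
    rfl
  have hL : ∀ w : ℤ → V, φ (colOp V D (PiTensorProduct.tprod ℂ (fun x => w (x : ℤ × ℤ).1))) =
      ψ (colOp V _ (PiTensorProduct.tprod ℂ (fun x => w (x : ℤ × ℤ).1)))
        (colOp V _ (PiTensorProduct.tprod ℂ (fun x => w (x : ℤ × ℤ).1))) := by
    intro w
    rw [hψ, ← splitT_colOp, splitT_tprod]
    congr 3
    ext x
    obtain ⟨y, rfl⟩ := (splitEquiv D j₀).surjective x
    rw [Equiv.symm_apply_apply]
    rcases y with y | y <;> rfl
  have hdet : ∀ u t, ψ (colOp V _ (PiTensorProduct.tprod ℂ u)) t =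
      b.det u * ψ (colOp V _ (PiTensorProduct.tprod ℂ b)) t := by
    intro u t
    rw [hψ, hψ, colOp_column _ j₀ hc, colOp_column _ j₀ hc,
      alt_eq_det b (MultilinearMap.alternatization (PiTensorProduct.tprod ℂ)) u,
      ← TensorProduct.smul_tmul', map_smul, map_smul, smul_eq_mul]
  rw [comp_youngOp_eq_zero, hR]
  constructor
  · intro h u w
    rw [hdet]
    refine mul_eq_zero_of_right _ ?_
    clear_value ψ
    let H : MultilinearMap ℂ (fun _ : (D.filter (fun x => x.2 ≠ j₀)) => V) ℂ :=
      (ψ (colOp V _ (PiTensorProduct.tprod ℂ b)) ∘ₗ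
        colOp V (D.filter (fun x => x.2 ≠ j₀))).compMultilinearMap (PiTensorProduct.tprod ℂ)
    have hH : ∀ v, H v = ψ (colOp V _ (PiTensorProduct.tprod ℂ b))
        (colOp V _ (PiTensorProduct.tprod ℂ v)) := fun v => rfl
    clear_value H
    rw [← hH]
    refine density_aux b (fun x : (D.filter (fun x => x.2 = j₀)) => (x : ℤ × ℤ).1) ?_
      (fun x : (D.filter (fun x => x.2 ≠ j₀)) => (x : ℤ × ℤ).1) H ?_ w
    · intro x y hxy
      exact Subtype.ext (Prod.ext hxy (by rw [hc _ x.2, hc _ y.2]))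
    · intro w
      have := h w
      rw [hL, hdet, ← hH] at this
      exact this
  · intro h w
    rw [hL]
    exact h _ w

theorem schur_split {V : Type*} [AddCommGroup V] [Module ℂ V] (D : Finset (ℤ × ℤ)) (j₀ : ℤ)
    (b : Module.Basis (D.filter (fun x => x.2 = j₀)) ℂ V) :
    LinearMap.range ((splitT V D j₀).toLinearMap ∘ₗ
      TensorProduct.mapIncl (schurModule V (D.filter (fun x => x.2 = j₀)))
        (schurModule V (D.filter (fun x => x.2 ≠ j₀)))) = schurModule V D := by
  have h1 : LinearMap.range ((splitT V D j₀).toLinearMap ∘ₗ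
      TensorProduct.mapIncl (schurModule V (D.filter (fun x => x.2 = j₀)))
        (schurModule V (D.filter (fun x => x.2 ≠ j₀)))) =
      LinearMap.range ((splitT V D j₀).toLinearMap ∘ₗ
        TensorProduct.map (youngOp V _) (youngOp V _)) := by
    rw [LinearMap.range_comp, LinearMap.range_comp, TensorProduct.range_mapIncl,
      TensorProduct.range_map]
    rfl
  rw [h1, schurModule]
  have hA : ∀ φ : (⨂[ℂ] _ : D, V) →ₗ[ℂ] ℂ, φ ∘ₗ youngOp V D = 0 ↔
      ∀ v, φ (youngOp V D (PiTensorProduct.tprod ℂ v)) = 0 := by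
    intro φ
    constructor
    · intro h v
      exact DFunLike.congr_fun h _
    · intro h
      ext v
      exact h v
  have hB : ∀ φ : (⨂[ℂ] _ : D, V) →ₗ[ℂ] ℂ, φ ∘ₗ ((splitT V D j₀).toLinearMap ∘ₗ
        TensorProduct.map (youngOp V _) (youngOp V _)) = 0 ↔
      ∀ u v, φ (splitT V D j₀ (youngOp V _ (PiTensorProduct.tprod ℂ u) ⊗ₜ
        youngOp V _ (PiTensorProduct.tprod ℂ v))) = 0 := by
    intro φ
    constructor
    · intro h u v
      exact DFunLike.congr_fun h (PiTensorProduct.tprod ℂ u ⊗ₜ PiTensorProduct.tprod ℂ v)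
    · intro h
      ext u v
      exact h u v
  apply le_antisymm
  · apply range_le_of_dual
    intro φ h
    rw [hB, ← key_aux D j₀ b, ← hA]
    exact h
  · apply range_le_of_dual
    intro φ h
    rw [hA, key_aux D j₀ b, ← hB]
    exact h

theorem finrank_column {V : Type*} [AddCommGroup V] [Module ℂ V] (c : Finset (ℤ × ℤ)) (j₀ : ℤ)
    (hc : ∀ x ∈ c, x.2 = j₀) (b : Module.Basis c ℂ V) :
    Module.finrank ℂ (schurModule V c) = 1 := by
  have hY : ∀ u : c → V, youngOp V c (PiTensorProduct.tprod ℂ u) =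
      b.det u • youngOp V c (PiTensorProduct.tprod ℂ b) := by
    intro u
    rw [youngOp_column c j₀ hc, youngOp_column c j₀ hc, colOp_column c j₀ hc,
      colOp_column c j₀ hc]
    exact alt_eq_det b _ u
  have hspan : schurModule V c = Submodule.span ℂ {youngOp V c (PiTensorProduct.tprod ℂ b)} := by
    apply le_antisymm
    · rintro _ ⟨t, rfl⟩
      induction t using PiTensorProduct.induction_on with
      | smul_tprod r u =>
        rw [map_smul, hY u]
        exact Submodule.smul_mem _ _ (Submodule.smul_mem _ _ (Submodule.mem_span_singleton_self _))
      | add x y hx hy => rw [map_add]; exact Submodule.add_mem _ hx hy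
    · rw [Submodule.span_singleton_le_iff_mem]
      exact ⟨_, rfl⟩
  rw [hspan]
  apply finrank_span_singleton
  intro h0
  have h1 := congrArg (PiTensorProduct.lift (b.det : MultilinearMap ℂ (fun _ : c => V) ℂ)) h0
  rw [youngOp_column c j₀ hc, colOp_tprod, map_sum, map_zero] at h1
  have h2 : ∀ q : Equiv.Perm c, (PiTensorProduct.lift
      (b.det : MultilinearMap ℂ (fun _ : c => V) ℂ))
      (if (∀ x : c, ((q x : ℤ × ℤ)).2 = (x : ℤ × ℤ).2) then ((Equiv.Perm.sign q : ℤ) : ℂ) •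
        PiTensorProduct.tprod ℂ (fun x => b (q.symm x)) else 0) = 1 := by
    intro q
    rw [if_pos (fun x => by rw [hc _ (Subtype.prop _), hc _ x.2]), map_smul,
      PiTensorProduct.lift.tprod]
    have : b.det (fun x => b (q.symm x)) = Equiv.Perm.sign q.symm • b.det b :=
      AlternatingMap.map_perm _ _ _
    rw [AlternatingMap.coe_multilinearMap, this, Module.Basis.det_self, Equiv.Perm.sign_symm]
    rcases Int.units_eq_one_or (Equiv.Perm.sign q) with h | h <;> simp [h]
  simp only [h2] at h1
  simp [Fintype.card_perm, Nat.factorial_ne_zero] at h1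

/-- Let `V` have dimension `k ≥ 1` and let
`D ⊆ {1,…,k} × {1,…,m}` contain a full column `c` (the column of `D` through
`j₀`, consisting of all `(i, j₀)`, `1 ≤ i ≤ k`). Then there is a
`GL(V)`-equivariant linear isomorphism `V[D] ≅ V[c] ⊗ V[D \ c]`, where `V[c]`
is one-dimensional and isomorphic to the `k`-th exterior power of `V`. -/
theorem stmt15 (V : Type*) [AddCommGroup V] [Module ℂ V] [FiniteDimensional ℂ V]
    (k m : ℕ) (hk : 1 ≤ k) (hm : 1 ≤ m) (hdim : Module.finrank ℂ V = k)
    (D : Finset (ℤ × ℤ))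
    (hD : ∀ x ∈ D, 1 ≤ x.1 ∧ x.1 ≤ k ∧ 1 ≤ x.2 ∧ x.2 ≤ m)
    (j₀ : ℤ) (hcol : ∀ i : ℤ, 1 ≤ i → i ≤ k → (i, j₀) ∈ D) :
    (∃ (h : ∀ g : V ≃ₗ[ℂ] V, ∀ v ∈ schurModule V D,
        glOp V D g v ∈ schurModule V D)
      (h1 : ∀ g : V ≃ₗ[ℂ] V, ∀ v ∈ schurModule V (D.filter (fun x => x.2 = j₀)),
        glOp V (D.filter (fun x => x.2 = j₀)) g v ∈
          schurModule V (D.filter (fun x => x.2 = j₀)))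
      (h2 : ∀ g : V ≃ₗ[ℂ] V, ∀ v ∈ schurModule V (D.filter (fun x => x.2 ≠ j₀)),
        glOp V (D.filter (fun x => x.2 ≠ j₀)) g v ∈
          schurModule V (D.filter (fun x => x.2 ≠ j₀)))
      (e : ↥(schurModule V D) ≃ₗ[ℂ]
        (↥(schurModule V (D.filter (fun x => x.2 = j₀))) ⊗[ℂ]
          ↥(schurModule V (D.filter (fun x => x.2 ≠ j₀))))),
      ∀ (g : V ≃ₗ[ℂ] V) (v : ↥(schurModule V D)),
        e ⟨glOp V D g v, h g v v.2⟩ =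
          TensorProduct.map ((glOp V (D.filter (fun x => x.2 = j₀)) g).restrict (h1 g))
            ((glOp V (D.filter (fun x => x.2 ≠ j₀)) g).restrict (h2 g)) (e v)) ∧
    Module.finrank ℂ ↥(schurModule V (D.filter (fun x => x.2 = j₀))) = 1 ∧
    Nonempty (↥(schurModule V (D.filter (fun x => x.2 = j₀))) ≃ₗ[ℂ] ↥(⋀[ℂ]^k V)) := by
  have hc : ∀ x ∈ D.filter (fun x => x.2 = j₀), x.2 = j₀ := fun x hx => (Finset.mem_filter.1 hx).2
  have hcard : (D.filter (fun x => x.2 = j₀)).card = k := by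
    have : D.filter (fun x => x.2 = j₀) =
        (Finset.Icc (1 : ℤ) k).map ⟨fun i => (i, j₀), fun a b h => (Prod.ext_iff.1 h).1⟩ := by
      ext ⟨i, j⟩
      simp only [Finset.mem_filter, Finset.mem_map, Finset.mem_Icc]
      constructor
      · rintro ⟨h, rfl⟩
        exact ⟨i, ⟨(hD _ h).1, (hD _ h).2.1⟩, rfl⟩
      · rintro ⟨a, ⟨h1, h2⟩, h3⟩
        obtain ⟨rfl, rfl⟩ := Prod.ext_iff.1 h3
        exact ⟨hcol _ h1 h2, rfl⟩
    rw [this, Finset.card_map]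
    simp
  have b : Module.Basis (D.filter (fun x => x.2 = j₀)) ℂ V :=
    (Module.finBasisOfFinrankEq ℂ V hdim).reindex
      (Fintype.equivOfCardEq (by rw [Fintype.card_fin, Fintype.card_coe, hcard]))
  have hfin := finrank_column (V := V) _ j₀ hc b
  refine ⟨⟨schur_stable D, schur_stable _, schur_stable _, ?_⟩, hfin, ?_⟩
  · let Ψ := (splitT V D j₀).toLinearMap ∘ₗ
      TensorProduct.mapIncl (schurModule V (D.filter (fun x => x.2 = j₀)))
        (schurModule V (D.filter (fun x => x.2 ≠ j₀)))
    have hinj : Function.Injective Ψ := by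
      refine (splitT V D j₀).injective.comp ?_
      exact TensorProduct.map_injective_of_flat_flat _ _
        (Submodule.injective_subtype _) (Submodule.injective_subtype _)
    let e' := (LinearEquiv.ofInjective Ψ hinj).trans (LinearEquiv.ofEq _ _ (schur_split D j₀ b))
    have he' : ∀ t, ((e' t : schurModule V D) : ⨂[ℂ] _ : D, V) = Ψ t := fun t => rfl
    refine ⟨e'.symm, fun g v => ?_⟩
    rw [LinearEquiv.symm_apply_eq]
    obtain ⟨t, rfl⟩ := e'.surjective v
    rw [LinearEquiv.symm_apply_apply]
    apply Subtype.ext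
    refine Eq.trans ?_ (he' _).symm
    change glOp V D g (Ψ t) = _
    clear_value e'
    clear he'
    induction t using TensorProduct.induction_on with
    | zero => simp
    | tmul x y => exact splitT_glOp D j₀ g x y
    | add x y hx hy => simp only [map_add, hx, hy]
  · have h2 : Module.finrank ℂ (⋀[ℂ]^k V) = 1 := by
      rw [exteriorPower.finrank_eq, hdim, Nat.choose_self]
    have : Module.Finite ℂ (schurModule V (D.filter (fun x => x.2 = j₀))) :=
      Module.finite_of_finrank_pos (by rw [hfin]; exact one_pos)
    exact ⟨LinearEquiv.ofFinrankEq _ _ (hfin.trans h2.symm)⟩
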